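/- Let v_0,…,v_{k−1}, y_0,…,y_{k−1} ∈ ℝ^d, let R^{VY} ∈ ℝ^{k×k} be the upper triangular matrix with (R^{VY})_{ij} = v_iᵀ y_j for i ≤ j and 0 otherwise, and let A ∈ ℝ^{k×k} be symmetric. Then the 2k×2k block matrix M = [[0_{k×k}, R^{VY}], [(R^{VY})ᵀ, A]] is invertible if and only if v_iᵀ y_i ≠ 0 for all 0 ≤ i ≤ k−1. -/

import Mathlib

open Matrix

theorem Matrix.isUnit_fromBlocks_zero₁₁ {n α : Type*} [Fintype n] [DecidableEq n] [CommRing α]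
    {B C D : Matrix n n α} :
    IsUnit (fromBlocks 0 B C D) ↔ IsUnit B ∧ IsUnit C := by
  rw [← isUnit_submatrix_equiv (Equiv.refl (n ⊕ n)) (Equiv.sumComm n n)]
  have h : (fromBlocks 0 B C D).submatrix (Equiv.refl (n ⊕ n)) (Equiv.sumComm n n) =
      fromBlocks B 0 D C :=
    fromBlocks_submatrix_sum_swap_right 0 B C D id
  rw [h, isUnit_fromBlocks_zero₁₂]

theorem Matrix.BlockTriangular.isUnit_iff_forall_diag_ne_zero {n K : Type*} [Fintype n]
    [LinearOrder n] [Field K] {M : Matrix n n K} (hM : M.BlockTriangular id) :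
    IsUnit M ↔ ∀ i, M i i ≠ 0 := by
  simp [isUnit_iff_isUnit_det, det_of_isUpperTriangular hM, Finset.prod_ne_zero_iff]

theorem stmt_6 (d k : ℕ) (v y : Fin k → Fin d → ℝ)
    (Rvy : Matrix (Fin k) (Fin k) ℝ)
    (hRvy : Rvy = Matrix.of fun i j => if i ≤ j then v i ⬝ᵥ y j else 0)
    (A : Matrix (Fin k) (Fin k) ℝ) (hA : A.IsSymm) :
    IsUnit (fromBlocks (0 : Matrix (Fin k) (Fin k) ℝ) Rvy Rvyᵀ A) ↔
      ∀ i : Fin k, v i ⬝ᵥ y i ≠ 0 := by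
  have hR : Rvy.BlockTriangular id := by
    intro i j hij
    simp [hRvy, not_le.mpr (show j < i from hij)]
  rw [isUnit_fromBlocks_zero₁₁, isUnit_transpose, and_self, hR.isUnit_iff_forall_diag_ne_zero]
  simp [hRvy]
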